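/- If k : Z_{≥2} → Z_{≥0} is any function with k(g)/√g → ∞ as g → ∞, then C(0^{k(g)}, 2^{3g−3+k(g)}) → 0 as g → ∞, where (0^k, 2^{3g−3+k}) denotes the tuple consisting of k entries equal to 0 followed by 3g−3+k entries equal to 2. -/

import Mathlib

open scoped BigOperators

noncomputable section

namespace WittenAsym

/-- `g(d)` as a rational number: `g(d) = 1 + (∑ⱼ dⱼ − n)/3`. -/
def gQ (l : List ℕ) : ℚ := 1 + ((l.sum : ℚ) - (l.length : ℚ)) / 3

/-- `X(d)` as a rational number: `X(d) = (∑ⱼ (2dⱼ+1))/3 = 2g(d) − 2 + n`. -/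
def XQ (l : List ℕ) : ℚ := (2 * (l.sum : ℚ) + (l.length : ℚ)) / 3

/-- `X(d)` as a natural number (the correct value whenever `X(d)` is an integer). -/
def XN (l : List ℕ) : ℕ := (2 * l.sum + l.length) / 3

/-- `g(d)` is a nonnegative integer. -/
def IntegralG (l : List ℕ) : Prop := ∃ g : ℕ, (g : ℚ) = gQ l

/-- The subtuple of `r` indexed by the finite index set `I`. -/
def select (r : List ℕ) (I : Finset (Fin r.length)) : List ℕ :=
  ((List.finRange r.length).filter (fun i => i ∈ I)).map r.get

/-- The characterization of the normalized Witten intersection numbers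
`C(d) = 2^{2g(d)} ∏ⱼ (2dⱼ+1)!! / (3^{2g(d)-2+n} (2g(d)-3+n)!) ∫ ψ₁^{d₁}⋯ψₙ^{dₙ}`:
they form the unique family of rationals, symmetric in the entries of `d`, vanishing
when `g(d)` is not a nonnegative integer, with `C(0,0,0) = 1/3`, `C(1) = 1/6`,
and satisfying the DVV recursion whenever `X(d) = 2g(d) - 2 + n ≥ 2`. -/
structure IsNormalizedWitten (C : List ℕ → ℚ) : Prop where
  symm : ∀ {l l' : List ℕ}, l.Perm l' → C l = C l'
  init3 : C [0, 0, 0] = 1/3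
  init1 : C [1] = 1/6
  vanish : ∀ l : List ℕ, ¬ IntegralG l → C l = 0
  dvv : ∀ (d₁ : ℕ) (r : List ℕ), IntegralG (d₁ :: r) → 2 ≤ XQ (d₁ :: r) →
    C (d₁ :: r) =
      (∑ j : Fin r.length,
        if 1 ≤ d₁ + r.get j then
          (2 * (r.get j : ℚ) + 1) / (3 * (XQ (d₁ :: r) - 1)) *
            C (r.set j.val (d₁ + r.get j - 1))
        else 0)
      + ∑ a ∈ Finset.range (d₁ - 1),
          (2 / (3 * (XQ (d₁ :: r) - 1)) * C (a :: (d₁ - 2 - a) :: r)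
          + ∑ I : Finset (Fin r.length),
              if 3 ∣ (2 * (a + (select r I).sum) + (1 + (select r I).length)) then
                ((XN (a :: select r I) - 1).factorial : ℚ) *
                  ((XN ((d₁ - 2 - a) :: select r Iᶜ) - 1).factorial : ℚ) /
                  (6 * ((XN (d₁ :: r) - 1).factorial : ℚ)) *
                  C (a :: select r I) * C ((d₁ - 2 - a) :: select r Iᶜ)
              else 0)

/-- The integer weight `2 * sum + length`, i.e. `3 X`. -/
def W (l : List ℕ) : ℕ := 2 * l.sum + l.length

lemma W_cons (a : ℕ) (l : List ℕ) : W (a :: l) = 2 * a + 1 + W l := by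
  simp [W]; ring

lemma W_nil : W [] = 0 := by simp [W]

lemma W_perm {l l' : List ℕ} (h : l.Perm l') : W l = W l' := by
  simp [W, h.sum_eq, h.length_eq]

lemma XQ_eq (l : List ℕ) : XQ l = (W l : ℚ) / 3 := by
  simp [XQ, W]

lemma XN_eq (l : List ℕ) : XN l = W l / 3 := rfl

lemma W_of_integral {l : List ℕ} (h : IntegralG l) : ∃ X : ℕ, W l = 3 * X := by
  obtain ⟨g, hg⟩ := h
  unfold gQ at hg
  have h2 : (l.sum : ℚ) + 3 = l.length + 3 * g := by rw [hg]; ring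
  have h3 : l.sum + 3 = l.length + 3 * g := by exact_mod_cast h2
  refine ⟨(W l) / 3, ?_⟩
  unfold W
  omega

lemma sum_set' (r : List ℕ) (j : ℕ) (hj : j < r.length) (v : ℕ) :
    (r.set j v).sum + r[j] = r.sum + v := by
  induction r generalizing j with
  | nil => simp at hj
  | cons a r ih =>
    cases j with
    | zero => simp; ring
    | succ j =>
      have := ih j (by simpa using hj)
      simp only [List.set_cons_succ, List.sum_cons, List.getElem_cons_succ]
      omega

lemma W_set (r : List ℕ) (j : Fin r.length) (v : ℕ) :
    W (r.set j.val v) + 2 * r.get j = W r + 2 * v := by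
  have := sum_set' r j.val j.2 v
  simp only [W, List.length_set, List.get_eq_getElem]
  omega

lemma sum_get (r : List ℕ) (f : ℕ → ℚ) : ∑ j : Fin r.length, f (r.get j) = (r.map f).sum := by
  induction r with
  | nil => simp
  | cons a r ih =>
    rw [List.map_cons, List.sum_cons, ← ih]
    exact Fin.sum_univ_succ (n := r.length) _

lemma sum_W (r : List ℕ) : ∑ j : Fin r.length, (2 * (r.get j : ℚ) + 1) = W r := by
  rw [sum_get r (fun x => 2 * (x : ℚ) + 1)]
  induction r with
  | nil => simp [W]
  | cons a r ih => rw [List.map_cons, List.sum_cons, ih, W_cons]; push_cast; ring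

lemma sum_W_nat (r : List ℕ) : ∑ j : Fin r.length, (2 * r.get j + 1) = W r := by
  have := sum_W r
  exact_mod_cast this

lemma select_list (r : List ℕ) (I : Finset (Fin r.length)) :
    ((List.finRange r.length).filter (fun i => i ∈ I)).toFinset = I := by
  ext i; simp

lemma W_select (r : List ℕ) (I : Finset (Fin r.length)) :
    W (select r I) = ∑ j ∈ I, (2 * r.get j + 1) := by
  have hn : ((List.finRange r.length).filter (fun i => i ∈ I)).Nodup :=
    (List.nodup_finRange _).filter _
  have h1 : (select r I).sum = ∑ j ∈ I, r.get j := by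
    unfold select
    rw [← List.sum_toFinset _ hn, select_list]
  have h2 : (select r I).length = I.card := by
    unfold select
    rw [List.length_map, ← List.toFinset_card_of_nodup hn, select_list]
  rw [W, h1, h2, Finset.sum_add_distrib, ← Finset.mul_sum]
  simp

lemma mem_select {r : List ℕ} {I : Finset (Fin r.length)} {x : ℕ} (h : x ∈ select r I) :
    x ∈ r := by
  unfold select at h
  obtain ⟨i, _, rfl⟩ := List.mem_map.1 h
  exact List.get_mem r i

lemma mem_set_cases {r : List ℕ} {j v x : ℕ} (h : x ∈ r.set j v) : x ∈ r ∨ x = v :=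
  List.mem_or_eq_of_mem_set h

/-- The base cases: weight three. -/
lemma eq_of_W_three {l : List ℕ} (h : W l = 3) : l = [1] ∨ l = [0, 0, 0] := by
  match l, h with
  | [], h => simp [W] at h
  | [a], h => simp [W] at h; left; simp [h]
  | [a, b], h => simp [W] at h; try omega
  | [a, b, c], h => simp [W] at h; right; simp; omega
  | a :: b :: c :: d :: l, h => simp [W] at h; omega

lemma C_nonneg {C : List ℕ → ℚ} (hC : IsNormalizedWitten C) :
    ∀ (w : ℕ) (l : List ℕ), W l < w → l ≠ [] → 0 ≤ C l := by
  intro w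
  induction w with
  | zero => intro l h; omega
  | succ w ih =>
    intro l hl hne
    by_cases hI : IntegralG l
    swap
    · rw [hC.vanish l hI]
    obtain ⟨X, hX⟩ := W_of_integral hI
    match l, hne with
    | d :: r, _ =>
    have hW := W_cons d r
    have hXQ : XQ (d :: r) = X := by rw [XQ_eq, hX]; push_cast; ring
    by_cases h2 : 2 ≤ X
    · have h2' : (2 : ℚ) ≤ X := by exact_mod_cast h2
      rw [hC.dvv d r hI (by rw [hXQ]; exact h2'), hXQ]
      have hX1 : (0 : ℚ) ≤ 3 * (X - 1) := by linarith
      refine add_nonneg (Finset.sum_nonneg ?_) (Finset.sum_nonneg ?_)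
      · intro j _
        split_ifs with h
        · refine mul_nonneg (div_nonneg (by positivity) hX1) (ih _ ?_ ?_)
          · have := W_set r j (d + r.get j - 1)
            omega
          · have := j.2
            intro h0
            have h1 := congrArg List.length h0
            rw [List.length_set, List.length_nil] at h1
            omega
        · exact le_rfl
      · intro a ha
        have ha' := Finset.mem_range.1 ha
        refine add_nonneg (mul_nonneg (div_nonneg (by norm_num) hX1) (ih _ ?_ (by simp)))
          (Finset.sum_nonneg ?_)
        · rw [W_cons, W_cons]; omega
        · intro I _
          split_ifs with h
          · have hs : ∀ I : Finset (Fin r.length), W (select r I) ≤ W r := by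
              intro I
              rw [W_select, ← sum_W_nat]
              exact Finset.sum_le_sum_of_subset (Finset.subset_univ _)
            have h1 := hs I
            have h3 := hs Iᶜ
            refine mul_nonneg (mul_nonneg (by positivity) (ih _ ?_ (by simp))) (ih _ ?_ (by simp))
            · rw [W_cons]; omega
            · rw [W_cons]; omega
          · exact le_rfl
    · have h3 : W (d :: r) = 3 := by omega
      rcases eq_of_W_three h3 with h | h
      · rw [h, hC.init1]; norm_num
      · rw [h, hC.init3]; norm_num

lemma C_nonneg' {C : List ℕ → ℚ} (hC : IsNormalizedWitten C) (l : List ℕ) (h : l ≠ []) :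
    0 ≤ C l := C_nonneg hC _ l (Nat.lt_succ_self _) h

/-- Dilaton equation. -/
lemma dilaton {C : List ℕ → ℚ} (hC : IsNormalizedWitten C) (r : List ℕ)
    (hI : IntegralG (1 :: r)) (h : 3 < W (1 :: r)) : C (1 :: r) = C r := by
  obtain ⟨X, hX⟩ := W_of_integral hI
  have h2 : 2 ≤ X := by omega
  have hXQ : XQ (1 :: r) = X := by rw [XQ_eq, hX]; push_cast; ring
  have h2' : (2 : ℚ) ≤ X := by exact_mod_cast h2
  rw [hC.dvv 1 r hI (by rw [hXQ]; exact h2'), hXQ]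
  have hW : (W r : ℚ) = 3 * (X - 1) := by
    have := W_cons 1 r
    have h' : (W r : ℚ) + 3 = 3 * X := by
      have : W r + 3 = 3 * X := by omega
      exact_mod_cast this
    linarith
  have h0 : (W r : ℚ) ≠ 0 := by rw [hW]; intro h; linarith
  have : ∀ j : Fin r.length, (if 1 ≤ 1 + r.get j then
      (2 * (r.get j : ℚ) + 1) / (3 * ((X : ℚ) - 1)) * C (r.set j.val (1 + r.get j - 1)) else 0)
      = (2 * (r.get j : ℚ) + 1) * (C r / W r) := by
    intro j
    rw [if_pos (by omega), ← hW]
    have : r.set j.val (1 + r.get j - 1) = r := by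
      rw [Nat.add_sub_cancel_left]; simp
    rw [this]; ring
  rw [Finset.sum_congr rfl (fun j _ => this j), ← Finset.sum_mul, sum_W]
  simp
  field_simp

/-- String equation. -/
lemma string_eq {C : List ℕ → ℚ} (hC : IsNormalizedWitten C) (r : List ℕ)
    (hI : IntegralG (0 :: r)) (h : 3 < W (0 :: r)) :
    C (0 :: r) = ∑ j : Fin r.length, if 1 ≤ r.get j then
      (2 * (r.get j : ℚ) + 1) / ((W r : ℚ) - 2) * C (r.set j.val (r.get j - 1)) else 0 := by
  obtain ⟨X, hX⟩ := W_of_integral hI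
  have h2 : 2 ≤ X := by omega
  have hXQ : XQ (0 :: r) = X := by rw [XQ_eq, hX]; push_cast; ring
  have h2' : (2 : ℚ) ≤ X := by exact_mod_cast h2
  rw [hC.dvv 0 r hI (by rw [hXQ]; exact h2'), hXQ]
  have hW : (W r : ℚ) - 2 = 3 * (X - 1) := by
    have := W_cons 0 r
    have h' : (W r : ℚ) + 1 = 3 * X := by
      have : W r + 1 = 3 * X := by omega
      exact_mod_cast this
    linarith
  simp [hW]

/-- Vandermonde consequence. -/
lemma choose_mul_le (i j u v : ℕ) :
    (i + j).choose i * (u + v).choose u ≤ (i + j + (u + v)).choose (i + u) := by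
  rw [Nat.add_choose_eq (i + j) (u + v) (i + u)]
  exact Finset.single_le_sum (f := fun ij : ℕ × ℕ => (i + j).choose ij.1 * (u + v).choose ij.2)
    (fun _ _ => Nat.zero_le _) (Finset.HasAntidiagonal.mem_antidiagonal.2
      (rfl : i + u = i + u) : ((i, u) : ℕ × ℕ) ∈ _)

lemma choose_ge_add (u v : ℕ) (hu : 1 ≤ u) (hv : 1 ≤ v) : u + v ≤ (u + v).choose u := by
  have := choose_mul_le 1 (v) (u-1) 0
  obtain ⟨u, rfl⟩ : ∃ t, u = t + 1 := ⟨u - 1, by omega⟩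
  obtain ⟨v, rfl⟩ : ∃ t, v = t + 1 := ⟨v - 1, by omega⟩
  induction u with
  | zero => simp
  | succ u ih =>
    have h1 := ih (by omega) (choose_mul_le 1 (v+1) (u+1-1) 0)
    have e : u + 1 + 1 + (v + 1) = (u + 1 + (v + 1)) + 1 := by ring
    rw [e, Nat.choose_succ_succ]
    have : 0 < (u + 1 + (v + 1)).choose (u + 1 + 1) := Nat.choose_pos (by omega)
    simp only [Nat.succ_eq_add_one] at *
    omega


lemma choose_ratio (s p m i : ℕ) (hp : p ≤ s) (hi : i ≤ m) (h1 : 5 * i ≤ 3 * p + 2)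
    (h2 : 5 * (m - i) ≤ 3 * (s - p) + 2) :
    ((s.choose p : ℚ))⁻¹ ≤
      (if 2 ≤ p ∧ p + 2 ≤ s then 10 / (s : ℚ) else 1) * ((m.choose i : ℚ))⁻¹ := by
  have hsp : (0 : ℚ) < s.choose p := by exact_mod_cast Nat.choose_pos hp
  have hmi : (0 : ℚ) < m.choose i := by exact_mod_cast Nat.choose_pos hi
  have key := choose_mul_le i (m - i) (p - i) (s - p - (m - i))
  rw [show i + (m - i) = m by omega, show p - i + (s - p - (m - i)) = s - m by omega,
    show m + (s - m) = s by omega, show i + (p - i) = p by omega] at key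
  rw [inv_eq_one_div, inv_eq_one_div, mul_one_div, div_le_div_iff₀ hsp hmi, one_mul]
  split_ifs with h
  · have h3 := choose_ge_add (p - i) (s - p - (m - i)) (by omega) (by omega)
    rw [show p - i + (s - p - (m - i)) = s - m by omega] at h3
    have hs : (0 : ℚ) < s := by exact_mod_cast (by omega : 0 < s)
    rw [div_mul_eq_mul_div, le_div_iff₀ hs]
    have h4 : s ≤ 10 * (s - m) := by omega
    have h5 : m.choose i * s ≤ 10 * s.choose p := by
      calc m.choose i * s ≤ m.choose i * (10 * (s - m)) := Nat.mul_le_mul_left _ h4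
        _ = 10 * (m.choose i * (s - m)) := by ring
        _ ≤ 10 * (m.choose i * (s - m).choose (p - i)) := by gcongr
        _ ≤ _ := by gcongr
    exact_mod_cast h5
  · have h3 : 0 < (s - m).choose (p - i) := Nat.choose_pos (by omega)
    have : m.choose i ≤ s.choose p := by nlinarith
    rw [one_mul]
    exact_mod_cast this

lemma sum_ratio (s : ℕ) :
    ∑ p ∈ Finset.range (s + 1), (if 2 ≤ p ∧ p + 2 ≤ s then 10 / (s : ℚ) else 1) ≤ 14 := by
  by_cases hs : s < 4
  · calc _ ≤ ∑ p ∈ Finset.range (s + 1), (1 : ℚ) := by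
          refine Finset.sum_le_sum fun p _ => ?_
          rw [if_neg (by omega)]
      _ = s + 1 := by simp
      _ ≤ 14 := by
        have : (s : ℚ) < 4 := by exact_mod_cast hs
        linarith
  · obtain ⟨t, rfl⟩ : ∃ t, s = t + 4 := ⟨s - 4, by omega⟩
    rw [show t + 4 + 1 = (t + 1) + 1 + 1 + 1 + 1 by ring, Finset.sum_range_succ,
      Finset.sum_range_succ, Finset.sum_range_succ', Finset.sum_range_succ']
    rw [if_neg (by omega), if_neg (by omega), if_neg (by omega), if_neg (by omega)]
    have : ∑ k ∈ Finset.range (t + 1),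
        (if 2 ≤ k + 1 + 1 ∧ k + 1 + 1 + 2 ≤ t + 4 then 10 / ((t + 4 : ℕ) : ℚ) else 1)
        = (t + 1) * (10 / ((t + 4 : ℕ) : ℚ)) := by
      rw [Finset.sum_congr rfl (g := fun _ => 10 / ((t + 4 : ℕ) : ℚ))]
      · simp
      · intro k hk
        have := Finset.mem_range.1 hk
        rw [if_pos (by omega)]
    rw [this]
    have h1 : ((t : ℚ) + 1) * (10 / ((t + 4 : ℕ) : ℚ)) ≤ 10 := by
      push_cast
      rw [mul_div_assoc', div_le_iff₀ (by positivity)]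
      have : (0 : ℚ) ≤ t := by positivity
      linarith
    linarith

/-- The combinatorial estimate for the quadratic term. -/
lemma comb (m d s : ℕ) (v : Fin m → ℕ) (hd : 2 ≤ d) (hv : ∀ j, 2 * d + 1 ≤ v j)
    (htot : 2 * (d - 2) + 2 + ∑ j, v j = 3 * (s + 2)) :
    ∑ a ∈ Finset.range (d - 1), ∑ I : Finset (Fin m),
      (if 3 ∣ 2 * a + 1 + ∑ j ∈ I, v j then
        ((s.choose ((2 * a + 1 + ∑ j ∈ I, v j) / 3 - 1) : ℚ))⁻¹ else 0) ≤ 14 := by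
  classical
  let F : ℕ → Finset (Finset (Fin m)) := fun p =>
    Finset.univ.filter (fun I => ∃ a, a < d - 1 ∧ 2 * a + 1 + ∑ j ∈ I, v j = 3 * (p + 1))
  have hanti : ∀ p, IsAntichain (· ⊆ ·) (SetLike.coe (F p)) := by
    intro p I hI J hJ hne hsub
    obtain ⟨a, ha, hIa⟩ := (Finset.mem_filter.1 (Finset.mem_coe.1 hI)).2
    obtain ⟨b, hb, hJb⟩ := (Finset.mem_filter.1 (Finset.mem_coe.1 hJ)).2
    obtain ⟨x, hxJ, hxI⟩ := Finset.exists_of_ssubset (Finset.ssubset_iff_subset_ne.2 ⟨hsub, hne⟩)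
    have h1 : ∑ j ∈ insert x I, v j ≤ ∑ j ∈ J, v j :=
      Finset.sum_le_sum_of_subset (Finset.insert_subset hxJ hsub)
    rw [Finset.sum_insert hxI] at h1
    have := hv x
    omega
  have hcard : ∀ I : Finset (Fin m), 5 * I.card ≤ ∑ j ∈ I, v j := by
    intro I
    have := Finset.card_nsmul_le_sum I v 5 (fun j _ => by have := hv j; omega)
    simpa [mul_comm] using this
  have step1 : ∀ a ∈ Finset.range (d - 1), ∀ I : Finset (Fin m),
      (if 3 ∣ 2 * a + 1 + ∑ j ∈ I, v j then
        ((s.choose ((2 * a + 1 + ∑ j ∈ I, v j) / 3 - 1) : ℚ))⁻¹ else 0) =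
      ∑ p ∈ Finset.range (s + 1), if 2 * a + 1 + ∑ j ∈ I, v j = 3 * (p + 1) then
        ((s.choose p : ℚ))⁻¹ else 0 := by
    intro a ha I
    have ha' := Finset.mem_range.1 ha
    have hsp := Finset.sum_add_sum_compl I v
    split_ifs with h
    · obtain ⟨x, hx⟩ := h
      rw [Finset.sum_eq_single (x - 1)]
      · rw [if_pos (by omega), hx, Nat.mul_div_cancel_left _ (by norm_num)]
      · intro p _ hp
        rw [if_neg (by omega)]
      · intro hn
        rw [Finset.mem_range] at hn
        omega
    · symm
      refine Finset.sum_eq_zero fun p _ => ?_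
      rw [if_neg]
      intro h'
      exact h ⟨_, h'⟩
  rw [Finset.sum_congr rfl (fun a ha => Finset.sum_congr rfl (fun I _ => step1 a ha I))]
  rw [Finset.sum_congr rfl (fun a _ => Finset.sum_comm), Finset.sum_comm]
  refine le_trans (Finset.sum_le_sum (fun p hp => ?_)) (sum_ratio s)
  have hp' := Finset.mem_range.1 hp
  rw [Finset.sum_comm]
  have step2 : ∀ I : Finset (Fin m), (∑ a ∈ Finset.range (d - 1),
      if 2 * a + 1 + ∑ j ∈ I, v j = 3 * (p + 1) then ((s.choose p : ℚ))⁻¹ else 0) ≤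
      if I ∈ F p then (if 2 ≤ p ∧ p + 2 ≤ s then 10 / (s : ℚ) else 1) *
        ((m.choose I.card : ℚ))⁻¹ else 0 := by
    intro I
    by_cases h : I ∈ F p
    · rw [if_pos h]
      obtain ⟨a, ha, hIa⟩ := (Finset.mem_filter.1 h).2
      rw [Finset.sum_eq_single a]
      · rw [if_pos hIa]
        have hsp := Finset.sum_add_sum_compl I v
        have h1 := hcard I
        have h2 := hcard Iᶜ
        have h3 : I.card ≤ m := by simpa using Finset.card_le_univ I
        rw [Finset.card_compl, Fintype.card_fin] at h2
        exact choose_ratio s p m I.card (by omega) h3 (by omega) (by omega)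
      · intro b _ hb
        rw [if_neg (by omega)]
      · intro hn
        exact absurd (Finset.mem_range.2 ha) hn
    · rw [if_neg h]
      refine (Finset.sum_eq_zero fun a ha => ?_).le
      rw [if_neg]
      intro h'
      exact h (Finset.mem_filter.2 ⟨Finset.mem_univ _, a, Finset.mem_range.1 ha, h'⟩)
  refine (Finset.sum_le_sum (fun I _ => step2 I)).trans ?_
  rw [← Finset.sum_filter, ← Finset.mul_sum]
  have hl := Finset.lubell_yamamoto_meshalkin_inequality_sum_inv_choose (𝕜 := ℚ) (hanti p)
  rw [Fintype.card_fin] at hl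
  have e : Finset.univ.filter (fun I => I ∈ F p) = F p := by ext; simp
  rw [e]
  refine (mul_le_mul_of_nonneg_left hl ?_).trans (mul_one _).le
  split_ifs <;> positivity

lemma frac_mono {a b c : ℚ} (ha : 0 ≤ a) (hab : a ≤ b) (hc : 0 < c) :
    a / (a + c) ≤ b / (b + c) := by
  rw [div_le_div_iff₀ (by linarith) (by linarith)]
  nlinarith

lemma G_bound {C : List ℕ → ℚ} (hC : IsNormalizedWitten C) (w : ℕ)
    (hP : ∀ l, l ≠ [] → (∀ d ∈ l, 1 ≤ d) → W l < w → C l ≤ (W l : ℚ) / (W l + 15)) :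
    ∀ (n : ℕ) (l : List ℕ), l.length = n → (∀ d ∈ l, 1 ≤ d) → W (0 :: l) < w →
      C (0 :: l) ≤ (W l : ℚ) / (W l + 13) := by
  intro n
  induction n with
  | zero =>
    intro l hl _ _
    have : l = [] := List.length_eq_zero_iff.1 hl
    subst this
    rw [hC.vanish]
    · positivity
    · intro h
      obtain ⟨X, hX⟩ := W_of_integral h
      simp [W] at hX
      omega
  | succ n ih =>
    intro l hl h1 hw
    by_cases hI : IntegralG (0 :: l)
    swap
    · rw [hC.vanish _ hI]; positivity
    by_cases hone : 1 ∈ l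
    · have hp := List.perm_cons_erase hone
      have hp2 : (0 :: l).Perm (1 :: 0 :: l.erase 1) :=
        (hp.cons 0).trans (List.Perm.swap _ _ _)
      have hWp := W_perm hp2
      rw [W_cons, W_cons, W_cons] at hWp
      have hI2 : IntegralG (1 :: 0 :: l.erase 1) := by
        unfold IntegralG gQ at hI ⊢
        rwa [hp2.sum_eq, hp2.length_eq] at hI
      have hI3 := W_of_integral hI2
      rw [W_cons, W_cons] at hI3
      rw [hC.symm hp2, dilaton hC _ hI2 (by rw [W_cons, W_cons]; omega)]
      refine (ih _ ?_ ?_ ?_).trans ?_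
      · rw [List.length_erase_of_mem hone, hl]; rfl
      · intro d hd
        exact h1 d (List.mem_of_mem_erase hd)
      · rw [W_cons] at hw ⊢; omega
      · exact frac_mono (by positivity) (by exact_mod_cast (by omega)) (by norm_num)
    · have h2 : ∀ d ∈ l, 2 ≤ d := by
        intro d hd
        have := h1 d hd
        have : d ≠ 1 := fun h => hone (h ▸ hd)
        omega
      have hW5 : 5 ≤ W l := by
        match l, hl with
        | d :: l, _ =>
          have := h2 d (by simp)
          rw [W_cons]; omega
      have hW5' : (5 : ℚ) ≤ W l := by exact_mod_cast hW5
      rw [W_cons] at hw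
      rw [string_eq hC l hI (by rw [W_cons]; omega)]
      calc _ ≤ ∑ j : Fin l.length, (2 * (l.get j : ℚ) + 1) * (1 / (W l + 13)) := by
            refine Finset.sum_le_sum fun j _ => ?_
            have hj := h2 _ (List.get_mem l j)
            rw [if_pos (by omega)]
            have hs := W_set l j (l.get j - 1)
            have hb := hP (l.set j.val (l.get j - 1)) ?_ ?_ (by omega)
            · have e : (W (l.set j.val (l.get j - 1)) : ℚ) = W l - 2 := by
                have : W (l.set j.val (l.get j - 1)) + 2 = W l := by omega
                rw [← this]; push_cast; ring
              rw [e] at hb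
              have : (2 * (l.get j : ℚ) + 1) * (1 / (W l + 13)) =
                  (2 * (l.get j : ℚ) + 1) / ((W l : ℚ) - 2) * (((W l : ℚ) - 2) / (W l - 2 + 15)) := by
                have : (W l : ℚ) - 2 ≠ 0 := by intro h; linarith
                have h' : (W l : ℚ) - 2 + 15 = W l + 13 := by ring
                rw [h']
                field_simp
              rw [this]
              exact mul_le_mul_of_nonneg_left hb (div_nonneg (by positivity) (by linarith))
            · intro h0
              have h1 := congrArg List.length h0
              rw [List.length_set, List.length_nil] at h1
              omega
            · intro d hd
              rcases mem_set_cases hd with h | h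
              · exact h1 d h
              · omega
        _ = _ := by rw [← Finset.sum_mul, sum_W]; ring

lemma GG_bound {C : List ℕ → ℚ} (hC : IsNormalizedWitten C) (w : ℕ)
    (hP : ∀ l, l ≠ [] → (∀ d ∈ l, 1 ≤ d) → W l < w → C l ≤ (W l : ℚ) / (W l + 15))
    (r : List ℕ) (hne : r ≠ []) (h2 : ∀ d ∈ r, 2 ≤ d) (hw : W (0 :: 0 :: r) < w) :
    C (0 :: 0 :: r) ≤ ((W r : ℚ) - 1) / (W r + 11) := by
  have hW5 : 5 ≤ W r := by
    match r, hne with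
    | d :: r, _ =>
      have := h2 d (by simp)
      rw [W_cons]; omega
  have hW5' : (5 : ℚ) ≤ W r := by exact_mod_cast hW5
  by_cases hI : IntegralG (0 :: 0 :: r)
  swap
  · rw [hC.vanish _ hI]; exact div_nonneg (by linarith) (by linarith)
  rw [W_cons, W_cons] at hw
  rw [string_eq hC (0 :: r) hI (by rw [W_cons, W_cons]; omega)]
  have e1 : (W (0 :: r) : ℚ) - 2 = W r - 1 := by rw [W_cons]; push_cast; ring
  rw [e1]
  have e2 : ∀ f : Fin (0 :: r).length → ℚ, ∑ j, f j = f ⟨0, by simp⟩ +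
      ∑ j : Fin r.length, f ⟨j.val + 1, by simp⟩ := fun f => Fin.sum_univ_succ (n := r.length) f
  rw [e2]
  simp only [List.get_eq_getElem, List.getElem_cons_zero, List.getElem_cons_succ,
    List.set_cons_succ]
  rw [if_neg (by omega), zero_add]
  calc _ ≤ ∑ j : Fin r.length, (2 * (r.get j : ℚ) + 1) *
          (1 / (W r - 1) * (((W r : ℚ) - 2) / (W r + 11))) := by
        refine Finset.sum_le_sum fun j _ => ?_
        have hj := h2 _ (List.get_mem r j)
        rw [List.get_eq_getElem] at *
        rw [if_pos (by omega)]
        have hs := W_set r j (r.get j - 1)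
        rw [List.get_eq_getElem] at *
        have hb := G_bound hC w hP _ (r.set j.val (r[j.val] - 1)) rfl ?_ (by rw [W_cons]; omega)
        · have e : (W (r.set j.val (r[j.val] - 1)) : ℚ) = W r - 2 := by
            have : W (r.set j.val (r[j.val] - 1)) + 2 = W r := by omega
            rw [← this]; push_cast; ring
          rw [e, show (W r : ℚ) - 2 + 13 = W r + 11 by ring] at hb
          rw [← mul_assoc, mul_one_div]
          exact mul_le_mul_of_nonneg_left hb (div_nonneg (by positivity) (by linarith))
        · intro d hd
          rcases mem_set_cases hd with h | h
          · have := h2 d h; omega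
          · omega
    _ = W r * (1 / (W r - 1) * (((W r : ℚ) - 2) / (W r + 11))) := by
        rw [← Finset.sum_mul, sum_W]
    _ ≤ _ := by
        have h1 : (0 : ℚ) < W r - 1 := by linarith
        have h3 : (0 : ℚ) < W r + 11 := by linarith
        rw [div_mul_div_comm, mul_div_assoc', div_le_div_iff₀ (by positivity) h3]
        nlinarith [mul_pos h1 h3]

lemma piece_bound {C : List ℕ → ℚ} (hC : IsNormalizedWitten C) (w : ℕ)
    (hP : ∀ l, l ≠ [] → (∀ d ∈ l, 1 ≤ d) → W l < w → C l ≤ (W l : ℚ) / (W l + 15))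
    (a : ℕ) (l : List ℕ) (h1 : ∀ d ∈ l, 1 ≤ d) (hw : W (a :: l) < w) :
    C (a :: l) ≤ (W (a :: l) : ℚ) / (W (a :: l) + 12) := by
  rcases Nat.eq_zero_or_pos a with rfl | ha
  · refine (G_bound hC w hP _ l rfl h1 hw).trans ?_
    rw [W_cons]
    push_cast
    have : (0 : ℚ) ≤ W l := by positivity
    rw [div_le_div_iff₀ (by positivity) (by positivity)]
    nlinarith
  · refine (hP (a :: l) (by simp) ?_ hw).trans ?_
    · intro d hd
      rcases List.mem_cons.1 hd with h | h
      · omega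
      · exact h1 d h
    · have : (0 : ℚ) ≤ W (a :: l) := by positivity
      rw [div_le_div_iff₀ (by positivity) (by positivity)]
      nlinarith

lemma prod_bound (x y : ℚ) (hx : 0 ≤ x) (hy : 0 ≤ y) :
    x / (x + 4) * (y / (y + 4)) ≤ (x + y) ^ 2 / (x + y + 8) ^ 2 := by
  rw [div_mul_div_comm, div_le_div_iff₀ (by positivity) (by positivity)]
  have hd := sq_nonneg (x - y)
  have hs : 0 ≤ x + y := by linarith
  have : (x + y) ^ 2 * ((x + 4) * (y + 4)) - x * y * (x + y + 8) ^ 2 =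
      (x - y) ^ 2 * (4 * (x + y) + 16) := by ring
  nlinarith [mul_nonneg hd (by linarith : (0 : ℚ) ≤ 4 * (x + y) + 16)]

lemma fact_ratio (s p : ℕ) (hp : p ≤ s) :
    ((p.factorial : ℚ) * ((s - p).factorial : ℚ)) / (6 * ((s + 2).factorial : ℚ)) =
      1 / (6 * (s + 2) * (s + 1)) * ((s.choose p : ℚ))⁻¹ := by
  have h := Nat.choose_mul_factorial_mul_factorial hp
  have h' : (s.choose p : ℚ) * p.factorial * (s - p).factorial = s.factorial := by exact_mod_cast h
  have h0 : (s.choose p : ℚ) ≠ 0 := by exact_mod_cast (Nat.choose_pos hp).ne'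
  have h1 : (s.factorial : ℚ) ≠ 0 := by exact_mod_cast (Nat.factorial_pos s).ne'
  rw [Nat.factorial_succ, Nat.factorial_succ]
  push_cast
  have h2 : ((s : ℚ) + 1) ≠ 0 := by positivity
  have h3 : ((s : ℚ) + 2) ≠ 0 := by positivity
  have h4 : ((s : ℚ) + 1 + 1) ≠ 0 := by positivity
  rw [← h'] at h1 ⊢
  have h5 : (p.factorial : ℚ) ≠ 0 := by exact_mod_cast (Nat.factorial_pos p).ne'
  have h6 : ((s - p).factorial : ℚ) ≠ 0 := by exact_mod_cast (Nat.factorial_pos _).ne'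
  field_simp
  ring

lemma quad_bound {C : List ℕ → ℚ} (hC : IsNormalizedWitten C) (w : ℕ)
    (hP : ∀ l, l ≠ [] → (∀ d ∈ l, 1 ≤ d) → W l < w → C l ≤ (W l : ℚ) / (W l + 15))
    (d : ℕ) (r : List ℕ) (hd : 2 ≤ d) (hmin : ∀ x ∈ r, d ≤ x) (hw : W (d :: r) = w)
    (s : ℕ) (hs : w = 3 * (s + 3)) :
    ∑ a ∈ Finset.range (d - 1), ∑ I : Finset (Fin r.length),
      (if 3 ∣ (2 * (a + (select r I).sum) + (1 + (select r I).length)) then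
        ((XN (a :: select r I) - 1).factorial : ℚ) *
          ((XN ((d - 2 - a) :: select r Iᶜ) - 1).factorial : ℚ) /
          (6 * ((XN (d :: r) - 1).factorial : ℚ)) *
          C (a :: select r I) * C ((d - 2 - a) :: select r Iᶜ)
      else 0) ≤ 14 * (((s : ℚ) + 2) / (6 * (s + 1) * (s + 10) ^ 2)) := by
  have hcomb := comb r.length d s (fun j => 2 * r.get j + 1) hd
    (fun j => by have := hmin _ (List.get_mem r j); omega)
    (by rw [sum_W_nat]; rw [W_cons] at hw; omega)
  have hk : (0 : ℚ) ≤ ((s : ℚ) + 2) / (6 * (s + 1) * (s + 10) ^ 2) := by positivity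
  refine le_trans ?_ (mul_le_mul_of_nonneg_right hcomb hk)
  rw [Finset.sum_mul]
  refine Finset.sum_le_sum fun a ha => ?_
  rw [Finset.sum_mul]
  refine Finset.sum_le_sum fun I _ => ?_
  have ha' := Finset.mem_range.1 ha
  have hWI : W (a :: select r I) = 2 * a + 1 + ∑ j ∈ I, (2 * r.get j + 1) := by
    rw [W_cons, W_select]
  have hWJ : W ((d - 2 - a) :: select r Iᶜ) =
      2 * (d - 2 - a) + 1 + ∑ j ∈ Iᶜ, (2 * r.get j + 1) := by
    rw [W_cons, W_select]
  have hsum := Finset.sum_add_sum_compl I (fun j => 2 * r.get j + 1)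
  rw [sum_W_nat] at hsum
  have hcond : 2 * (a + (select r I).sum) + (1 + (select r I).length) =
      2 * a + 1 + ∑ j ∈ I, (2 * r.get j + 1) := by
    rw [← hWI]; simp [W]; ring
  rw [hcond]
  split_ifs with h
  swap
  · simp
  obtain ⟨x, hx⟩ := h
  have hw' := hw
  rw [W_cons] at hw'
  rw [hx] at hWI
  obtain ⟨p, rfl⟩ : ∃ p, x = p + 1 := ⟨x - 1, by omega⟩
  have hps : p ≤ s := by omega
  have hWJ' : W ((d - 2 - a) :: select r Iᶜ) = 3 * (s - p + 1) := by omega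
  rw [XN_eq, XN_eq, XN_eq, hWI, hWJ', hw, hs, hx, Nat.mul_div_cancel_left _ (by norm_num),
    Nat.mul_div_cancel_left _ (by norm_num), Nat.mul_div_cancel_left _ (by norm_num),
    Nat.add_sub_cancel, Nat.add_sub_cancel, show s + 3 - 1 = s + 2 by omega, fact_ratio s p hps]
  have hsel : ∀ I : Finset (Fin r.length), ∀ x ∈ select r I, 1 ≤ x := by
    intro I x hx
    have := hmin x (mem_select hx)
    omega
  have b1 := piece_bound hC w hP a (select r I) (hsel I) (by omega)
  have b2 := piece_bound hC w hP (d - 2 - a) (select r Iᶜ) (hsel Iᶜ) (by omega)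
  have n2 := C_nonneg' hC ((d - 2 - a) :: select r Iᶜ) (by simp)
  rw [hWI] at b1
  rw [hWJ'] at b2
  have hsp : (((s - p : ℕ)) : ℚ) = s - p := by push_cast [hps]; ring
  have hps' : (p : ℚ) ≤ s := by exact_mod_cast hps
  have e1 : (((3 * (p + 1) : ℕ) : ℚ)) / ((3 * (p + 1) : ℕ) + 12) = (p + 1) / (((p : ℚ) + 1) + 4) := by
    push_cast
    rw [div_eq_div_iff (by positivity) (by positivity)]; ring
  have e2 : (((3 * (s - p + 1) : ℕ) : ℚ)) / ((3 * (s - p + 1) : ℕ) + 12) =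
      ((s : ℚ) - p + 1) / (((s : ℚ) - p + 1) + 4) := by
    push_cast
    rw [hsp, div_eq_div_iff (by linarith) (by linarith)]; ring
  rw [e1] at b1
  rw [e2] at b2
  have hprod : C (a :: select r I) * C ((d - 2 - a) :: select r Iᶜ) ≤
      ((s : ℚ) + 2) ^ 2 / (s + 10) ^ 2 := by
    refine (mul_le_mul b1 b2 n2 (by positivity)).trans ?_
    refine (prod_bound _ _ (by positivity) (by linarith)).trans (le_of_eq ?_)
    congr 1 <;> ring
  rw [mul_assoc]
  calc _ ≤ 1 / (6 * ((s : ℚ) + 2) * (s + 1)) * ((s.choose p : ℚ))⁻¹ *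
        (((s : ℚ) + 2) ^ 2 / (s + 10) ^ 2) := mul_le_mul_of_nonneg_left hprod (by positivity)
    _ = _ := by
      have h2 : ((s : ℚ) + 1) ≠ 0 := by positivity
      have h3 : ((s : ℚ) + 2) ≠ 0 := by positivity
      have h4 : ((s : ℚ) + 10) ≠ 0 := by positivity
      have h0 : (s.choose p : ℚ) ≠ 0 := by exact_mod_cast (Nat.choose_pos hps).ne'
      field_simp

lemma final_ineq (s : ℚ) (hs : 0 ≤ s) :
    (s + 2) / (s + 7) + 8 / 9 / ((s + 6) * (s + 7)) +
      14 * ((s + 2) / (6 * (s + 1) * (s + 10) ^ 2)) ≤ (s + 3) / (s + 8) := by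
  have e : (s + 3) / (s + 8) - (s + 2) / (s + 7) = 5 / ((s + 7) * (s + 8)) := by
    field_simp; ring
  have h1 : 8 / 9 / ((s + 6) * (s + 7)) ≤ (3 / 2) / ((s + 7) * (s + 8)) := by
    rw [div_le_div_iff₀ (by positivity) (by positivity)]
    nlinarith [mul_nonneg hs hs]
  have h2 : 14 * ((s + 2) / (6 * (s + 1) * (s + 10) ^ 2)) ≤ (7 / 2) / ((s + 7) * (s + 8)) := by
    rw [mul_div_assoc', div_le_div_iff₀ (by positivity) (by positivity)]
    have := pow_nonneg hs 2
    have := pow_nonneg hs 3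
    nlinarith
  have e3 : 5 / ((s + 7) * (s + 8)) = (3 / 2) / ((s + 7) * (s + 8)) + (7 / 2) / ((s + 7) * (s + 8)) := by
    rw [← add_div]; norm_num
  linarith

lemma main_step {C : List ℕ → ℚ} (hC : IsNormalizedWitten C) (w : ℕ)
    (hP : ∀ l, l ≠ [] → (∀ d ∈ l, 1 ≤ d) → W l < w → C l ≤ (W l : ℚ) / (W l + 15))
    (d : ℕ) (r : List ℕ) (hd : 2 ≤ d) (hmin : ∀ x ∈ r, d ≤ x) (hw : W (d :: r) = w)
    (hI : IntegralG (d :: r)) : C (d :: r) ≤ (w : ℚ) / (w + 15) := by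
  obtain ⟨X, hX⟩ := W_of_integral hI
  have hw' := hw
  rw [W_cons] at hw'
  have hr5 : r ≠ [] → 5 ≤ W r := by
    intro hne
    match r, hne with
    | x :: r, _ =>
      have := hmin x (by simp)
      rw [W_cons]; omega
  have hX3 : 3 ≤ X := by
    by_cases hr : r = []
    · subst hr; rw [W_nil] at hw'; omega
    · have := hr5 hr; omega
  obtain ⟨s, rfl⟩ : ∃ s, X = s + 3 := ⟨X - 3, by omega⟩
  have hs0 : (0 : ℚ) ≤ s := by positivity
  have hXQ : XQ (d :: r) = s + 3 := by rw [XQ_eq, hX]; push_cast; ring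
  have hq := quad_bound hC w hP d r hd hmin hw s (by omega)
  rw [hC.dvv d r hI (by rw [hXQ]; linarith), hXQ, Finset.sum_add_distrib, ← add_assoc]
  have e0 : (3 * ((s : ℚ) + 3 - 1)) = 3 * (s + 2) := by ring
  rw [e0]
  have hWr : (W r : ℚ) = 3 * s + 8 - 2 * d := by
    have : 2 * d + 1 + W r = 3 * (s + 3) := by omega
    have h' : 2 * (d : ℚ) + 1 + W r = 3 * (s + 3) := by exact_mod_cast this
    linarith
  -- first sum
  have hT1 : (∑ j : Fin r.length, if 1 ≤ d + r.get j then
      (2 * (r.get j : ℚ) + 1) / (3 * (s + 2)) * C (r.set j.val (d + r.get j - 1)) else 0) ≤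
      (3 * s + 8 - 2 * d) * (1 / (3 * (s + 2)) * ((s + 2) / (s + 7))) := by
    rw [← hWr, ← sum_W, Finset.sum_mul]
    refine Finset.sum_le_sum fun j _ => ?_
    rw [if_pos (by omega)]
    have hset := W_set r j (d + r.get j - 1)
    have hWs : W (r.set j.val (d + r.get j - 1)) = 3 * (s + 2) := by omega
    have hj := hmin _ (List.get_mem r j)
    have hb := hP (r.set j.val (d + r.get j - 1)) ?_ ?_ (by omega)
    · rw [hWs] at hb
      have e : (((3 * (s + 2) : ℕ) : ℚ)) / ((3 * (s + 2) : ℕ) + 15) = (s + 2) / ((s : ℚ) + 7) := by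
        push_cast
        rw [div_eq_div_iff (by positivity) (by positivity)]; ring
      rw [e] at hb
      rw [← mul_assoc, mul_one_div]
      exact mul_le_mul_of_nonneg_left hb (by positivity)
    · intro h0
      rw [h0, W_nil] at hWs
      omega
    · intro x hx
      rcases mem_set_cases hx with h | h
      · have := hmin x h; omega
      · omega
  -- second sum
  have hT2 : (∑ a ∈ Finset.range (d - 1), 2 / (3 * ((s : ℚ) + 2)) * C (a :: (d - 2 - a) :: r)) ≤
      2 / (3 * ((s : ℚ) + 2)) * ((d - 1) * ((s + 2) / (s + 7)) +
        2 * (2 / 3 * ((s + 2) / ((s + 6) * (s + 7))))) := by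
    rw [← Finset.mul_sum]
    refine mul_le_mul_of_nonneg_left ?_ (by positivity)
    set E : ℚ := 2 / 3 * ((s + 2) / ((s + 6) * (s + 7))) with hE
    have hE0 : 0 ≤ E := by positivity
    have hone : ∀ (b : ℕ) (l : List ℕ), 1 ≤ b → (∀ x ∈ l, 2 ≤ x) → W (0 :: b :: l) = 3 * (s + 2) →
        C (0 :: b :: l) ≤ (s + 2) / (s + 7) + E := by
      intro b l hb hl hW
      refine (G_bound hC w hP _ (b :: l) rfl ?_ (by omega)).trans ?_
      · intro x hx
        rcases List.mem_cons.1 hx with h | h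
        · omega
        · have := hl x h; omega
      · rw [W_cons] at hW
        have : W (b :: l) = 3 * s + 5 := by omega
        rw [this, hE]
        push_cast
        rw [mul_div_assoc', div_add_div _ _ (by positivity) (by positivity),
          div_le_div_iff₀ (by positivity) (by positivity)]
        have := pow_nonneg hs0 2
        have := pow_nonneg hs0 3
        nlinarith
    have hrr : ∀ x ∈ r, 2 ≤ x := fun x hx => hd.trans (hmin x hx)
    calc _ ≤ ∑ a ∈ Finset.range (d - 1), (((s : ℚ) + 2) / (s + 7) +
          ((if a = 0 then E else 0) + (if a = d - 2 then E else 0))) := by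
          refine Finset.sum_le_sum fun a ha => ?_
          have ha' := Finset.mem_range.1 ha
          have hWab : W (a :: (d - 2 - a) :: r) = 3 * (s + 2) := by
            rw [W_cons, W_cons]; omega
          by_cases h0 : a = 0
          · rw [if_pos h0]
            subst h0
            by_cases h2 : 0 = d - 2
            · rw [if_pos h2]
              rw [show d - 2 - 0 = 0 by omega] at hWab ⊢
              have hWr' : W r = 3 * s + 4 := by
                rw [W_cons, W_cons] at hWab; omega
              have hne : r ≠ [] := by
                intro h; rw [h, W_nil] at hWr'; omega
              refine (GG_bound hC w hP r hne hrr (by omega)).trans ?_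
              rw [hWr', hE]
              push_cast
              rw [mul_div_assoc', ← add_div, div_add_div _ _ (by positivity) (by positivity),
                div_le_div_iff₀ (by positivity) (by positivity)]
              have := pow_nonneg hs0 2
              have := pow_nonneg hs0 3
              nlinarith
            · rw [if_neg h2, add_zero]
              exact hone _ _ (by omega) hrr hWab
          · rw [if_neg h0]
            by_cases h2 : a = d - 2
            · rw [if_pos h2, zero_add]
              rw [show d - 2 - a = 0 by omega] at hWab ⊢
              rw [hC.symm (List.Perm.swap 0 a r)]
              exact hone _ _ (by omega) hrr (by rw [W_cons, W_cons] at hWab ⊢; omega)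
            · rw [if_neg h2, add_zero, add_zero]
              refine (hP _ (by simp) ?_ (by omega)).trans (le_of_eq ?_)
              · intro x hx
                rcases List.mem_cons.1 hx with h | h
                · omega
                · rcases List.mem_cons.1 h with h | h
                  · omega
                  · have := hrr x h; omega
              · rw [hWab]
                push_cast
                rw [div_eq_div_iff (by positivity) (by positivity)]; ring
      _ = _ := by
          rw [Finset.sum_add_distrib, Finset.sum_add_distrib, Finset.sum_ite_eq',
            Finset.sum_ite_eq', if_pos (Finset.mem_range.2 (by omega)),
            if_pos (Finset.mem_range.2 (by omega)), Finset.sum_const, Finset.card_range,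
            nsmul_eq_mul, Nat.cast_sub (by omega)]
          push_cast
          ring
  have hfin := final_ineq s hs0
  have hgoal : (w : ℚ) / (w + 15) = (s + 3) / (s + 8) := by
    rw [← hw, hX]
    push_cast
    rw [div_eq_div_iff (by positivity) (by positivity)]; ring
  rw [hgoal]
  refine le_trans ?_ hfin
  have hcomb : (3 * (s : ℚ) + 8 - 2 * d) * (1 / (3 * (s + 2)) * ((s + 2) / (s + 7))) +
      2 / (3 * ((s : ℚ) + 2)) * ((d - 1) * ((s + 2) / (s + 7)) +
        2 * (2 / 3 * ((s + 2) / ((s + 6) * (s + 7))))) =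
      (s + 2) / (s + 7) + 8 / 9 / ((s + 6) * (s + 7)) := by
    field_simp
    ring
  rw [← hcomb]
  exact add_le_add (add_le_add hT1 hT2) hq

/-- The uniform bound for tuples without zeros. -/
lemma main_bound {C : List ℕ → ℚ} (hC : IsNormalizedWitten C) :
    ∀ (w : ℕ) (l : List ℕ), l ≠ [] → (∀ d ∈ l, 1 ≤ d) → W l < w →
      C l ≤ (W l : ℚ) / (W l + 15) := by
  intro w
  induction w with
  | zero => intro l _ _ h; omega
  | succ w ih =>
    intro l hne h1 hw
    by_cases hI : IntegralG l
    swap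
    · rw [hC.vanish _ hI]; positivity
    have hperm : ∀ l', l.Perm l' → IntegralG l' := by
      intro l' hp
      unfold IntegralG gQ at hI ⊢
      rwa [hp.sum_eq, hp.length_eq] at hI
    obtain ⟨X, hX⟩ := W_of_integral hI
    by_cases hone : 1 ∈ l
    · have hp := List.perm_cons_erase hone
      have hWp := W_perm hp
      rw [W_cons] at hWp
      rw [hC.symm hp]
      by_cases he : l.erase 1 = []
      · rw [he, hC.init1, hWp, he, W_nil]; norm_num
      · have hlt : 0 < W (l.erase 1) := by
          match l.erase 1, he with
          | x :: t, _ => rw [W_cons]; omega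
        rw [dilaton hC _ (hperm _ hp) (by rw [W_cons]; omega)]
        refine (ih _ he (fun d hd => h1 d (List.mem_of_mem_erase hd)) (by omega)).trans ?_
        exact frac_mono (by positivity) (by exact_mod_cast (by omega)) (by norm_num)
    · have h2 : ∀ d ∈ l, 2 ≤ d := by
        intro d hd
        have := h1 d hd
        have : d ≠ 1 := fun h => hone (h ▸ hd)
        omega
      obtain ⟨d, hdl, hdm⟩ : ∃ d ∈ l, ∀ x ∈ l, d ≤ x := by
        obtain ⟨d, hd, hm⟩ := Finset.exists_min_image l.toFinset id
          (by rwa [List.toFinset_nonempty_iff])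
        exact ⟨d, by simpa using hd, fun x hx => hm x (by simpa using hx)⟩
      have hp := List.perm_cons_erase hdl
      rw [hC.symm hp]
      exact main_step hC (W l) (fun l' a b c => ih l' a b (by omega)) d _ (h2 d hdl)
        (fun x hx => hdm x (List.mem_of_mem_erase hx)) (W_perm hp).symm (hperm _ hp)

lemma integral_zt (g k : ℕ) (hg : 2 ≤ g) :
    IntegralG (List.replicate k 0 ++ List.replicate (3 * g - 3 + k) 2) := by
  refine ⟨g, ?_⟩
  unfold gQ
  simp only [List.sum_append, List.sum_replicate, List.length_append, List.length_replicate,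
    smul_eq_mul]
  have h : ((3 * g - 3 : ℕ) : ℚ) = 3 * g - 3 := by
    rw [Nat.cast_sub (by omega)]; push_cast; ring
  push_cast [h]
  ring

lemma W_zt (k m : ℕ) : W (List.replicate k 0 ++ List.replicate m 2) = 5 * m + k := by
  simp [W]; ring

lemma zt_rec {C : List ℕ → ℚ} (hC : IsNormalizedWitten C) (k m : ℕ)
    (hI : IntegralG (List.replicate (k + 1) 0 ++ List.replicate (m + 1) 2)) (hm : 1 ≤ m) :
    C (List.replicate (k + 1) 0 ++ List.replicate (m + 1) 2) * (5 * (m + 1) + k - 2) =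
      5 * (m + 1) * C (List.replicate k 0 ++ List.replicate m 2) := by
  set r := List.replicate k 0 ++ List.replicate (m + 1) 2 with hr
  set B := C (List.replicate k 0 ++ List.replicate m 2) with hB
  have e0 : List.replicate (k + 1) 0 ++ List.replicate (m + 1) 2 = 0 :: r := by
    rw [List.replicate_succ]; rfl
  rw [e0] at hI ⊢
  have hWr : W r = 5 * (m + 1) + k := W_zt _ _
  have hWr' : (W r : ℚ) = 5 * (m + 1) + k := by rw [hWr]; push_cast; ring
  have hpr : r.Perm (2 :: (List.replicate k 0 ++ List.replicate m 2)) := by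
    rw [hr, List.replicate_succ]
    exact List.perm_middle
  rw [string_eq hC r hI (by rw [W_cons]; omega)]
  have hterm : ∀ j : Fin r.length, (if 1 ≤ r.get j then
      (2 * (r.get j : ℚ) + 1) / ((W r : ℚ) - 2) * C (r.set j.val (r.get j - 1)) else 0) =
      (fun x : ℕ => if 1 ≤ x then (2 * (x : ℚ) + 1) / ((W r : ℚ) - 2) * B else 0) (r.get j) := by
    intro j
    simp only
    split_ifs with h
    swap
    · rfl
    congr 1
    have hmem : r.get j ∈ r := List.get_mem r j
    have hall : ∀ x ∈ r, 1 ≤ x → x = 2 := by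
      intro x hx hx1
      rcases List.mem_append.1 hx with h' | h'
      · have := List.eq_of_mem_replicate h'
        omega
      · exact List.eq_of_mem_replicate h'
    have h2 : r.get j = 2 := hall _ hmem h
    rw [h2]
    have hp1 : (r.set j.val (2 - 1)).Perm (1 :: r.eraseIdx j.val) :=
      List.set_perm_cons_eraseIdx j.2 _
    have hp2 : (2 :: r.eraseIdx j.val).Perm r := by
      have := List.getElem_cons_eraseIdx_perm j.2
      rw [List.get_eq_getElem] at h2
      rwa [h2] at this
    have hp3 := (hp2.trans hpr).cons_inv
    have hp4 := hp1.trans (hp3.cons 1)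
    rw [hC.symm hp4]
    have hI0 : IntegralG (1 :: (List.replicate k 0 ++ List.replicate m 2)) := by
      obtain ⟨g, hg⟩ := hI
      refine ⟨g, ?_⟩
      rw [hg]
      unfold gQ
      have h1 := hpr.sum_eq
      have h2 := hpr.length_eq
      rw [List.sum_cons, List.length_cons, List.sum_cons, List.length_cons, h1, h2, List.sum_cons,
        List.length_cons]
      push_cast
      ring
    exact dilaton hC _ hI0 (by rw [W_cons, W_zt]; omega)
  rw [Finset.sum_congr rfl (fun j _ => hterm j),
    sum_get r (fun x : ℕ => if 1 ≤ x then (2 * (x : ℚ) + 1) / ((W r : ℚ) - 2) * B else 0)]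
  rw [hWr', hr, List.map_append, List.map_replicate, List.map_replicate, List.sum_append,
    List.sum_replicate, List.sum_replicate]
  have hm' : (1 : ℚ) ≤ m := by exact_mod_cast hm
  have hk' : (0 : ℚ) ≤ k := by positivity
  have hne : (5 * ((m : ℚ) + 1) + k - 2) ≠ 0 := by
    intro h; linarith
  norm_num
  have e5 : ((m : ℚ) + 1) * (5 / (5 * (m + 1) + k - 2) * B) * (5 * (m + 1) + k - 2) =
      (m + 1) * 5 * B * ((5 * (m + 1) + k - 2) / (5 * (m + 1) + k - 2)) := by ring
  rw [e5, div_self hne]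
  ring

lemma zt_bound {C : List ℕ → ℚ} (hC : IsNormalizedWitten C) (g K : ℕ) (hg : 2 ≤ g) :
    ∀ i : ℕ, i + 2 ≤ K →
      C (List.replicate (i + 2) 0 ++ List.replicate (3 * g - 3 + (i + 2)) 2) *
        (1 + ((i : ℚ) - 1) * i / (2 * (5 * (3 * g + K)))) ≤ 4 := by
  have hM : ((3 * g - 3 : ℕ) : ℚ) = 3 * g - 3 := by
    rw [Nat.cast_sub (by omega)]; push_cast; ring
  have hg' : (2 : ℚ) ≤ g := by exact_mod_cast hg
  have hnn : ∀ i : ℕ, 0 ≤ C (List.replicate i 0 ++ List.replicate (3 * g - 3 + i) 2) := by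
    intro i
    refine C_nonneg' hC _ ?_
    intro h
    have := congrArg List.length h
    simp at this
    omega
  have hrec : ∀ i : ℕ, C (List.replicate (i + 1) 0 ++ List.replicate (3 * g - 3 + (i + 1)) 2) *
      (5 * (3 * g - 3 + i + 1) + i - 2) = 5 * (3 * g - 3 + i + 1) *
        C (List.replicate i 0 ++ List.replicate (3 * g - 3 + i) 2) := by
    intro i
    have := zt_rec hC i (3 * g - 3 + i) (integral_zt g (i + 1) hg) (by omega)
    push_cast [hM] at this
    exact this
  intro i
  induction i with
  | zero =>
    intro _
    have b0 : C (List.replicate 0 0 ++ List.replicate (3 * g - 3 + 0) 2) ≤ 1 := by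
      refine (main_bound hC _ _ ?_ ?_ (Nat.lt_succ_self _)).trans ?_
      · intro h
        have := congrArg List.length h
        simp at this
        omega
      · intro d hd
        simp at hd
        omega
      · rw [div_le_one (by positivity)]; linarith
    have h1 := hrec 0
    have h2 := hrec 1
    have n1 := hnn 1
    have n2 := hnn 2
    norm_num at h1 h2 n1 n2 b0 ⊢
    have c1 : C (0 :: List.replicate (3 * g - 3 + 1) 2) ≤ 2 := by
      by_contra hcon
      push Not at hcon
      nlinarith
    by_contra hcon
    push Not at hcon
    nlinarith
  | succ i ih =>
    intro hi
    have ih' := ih (by omega)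
    have h := hrec (i + 2)
    have n3 := hnn (i + 2 + 1)
    rw [show i + 1 + 2 = i + 2 + 1 by ring]
    set a := C (List.replicate (i + 2) 0 ++ List.replicate (3 * g - 3 + (i + 2)) 2)
    set b := C (List.replicate (i + 2 + 1) 0 ++ List.replicate (3 * g - 3 + (i + 2 + 1)) 2)
    push_cast at h ⊢
    have hi0 : (0 : ℚ) ≤ i := by positivity
    have hiK : (i : ℚ) + 3 ≤ K := by exact_mod_cast (by omega : i + 3 ≤ K)
    set D : ℚ := 5 * (3 * g + K) with hD
    set m : ℚ := 5 * (3 * g - 3 + (i + 2) + 1) with hm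
    have hmD : m ≤ D := by rw [hm, hD]; linarith
    have hm0 : 0 < m := by rw [hm]; linarith
    have hD0 : 0 < D := by linarith
    -- a = b * (1 + i / m)
    have ha : a = b * (1 + i / m) := by
      field_simp
      linarith
    have hS : 0 ≤ 1 + ((i : ℚ) - 1) * i / (2 * D) := by
      have : (0 : ℚ) ≤ ((i : ℚ) - 1) * i := by
        rcases Nat.eq_zero_or_pos i with h | h
        · simp [h]
        · have : (1 : ℚ) ≤ i := by exact_mod_cast h
          exact mul_nonneg (by linarith) hi0
      positivity
    have hS1 : 1 ≤ 1 + ((i : ℚ) - 1) * i / (2 * D) := by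
      have : (0 : ℚ) ≤ ((i : ℚ) - 1) * i := by
        rcases Nat.eq_zero_or_pos i with h | h
        · simp [h]
        · have : (1 : ℚ) ≤ i := by exact_mod_cast h
          exact mul_nonneg (by linarith) hi0
      have : 0 ≤ ((i : ℚ) - 1) * i / (2 * D) := by positivity
      linarith
    have hstep : 1 + ((i : ℚ) + 1 - 1) * (i + 1) / (2 * D) ≤
        (1 + i / m) * (1 + ((i : ℚ) - 1) * i / (2 * D)) := by
      have h1 : (i : ℚ) / D ≤ i / m := div_le_div_of_nonneg_left hi0 hm0 hmD
      have h0 : 0 ≤ (i : ℚ) / D := by positivity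
      have e : 1 + ((i : ℚ) + 1 - 1) * (i + 1) / (2 * D) =
          (1 + ((i : ℚ) - 1) * i / (2 * D)) + i / D := by
        field_simp; ring
      rw [e]
      nlinarith
    calc b * _ ≤ b * ((1 + i / m) * (1 + ((i : ℚ) - 1) * i / (2 * D))) :=
          mul_le_mul_of_nonneg_left hstep n3
      _ = a * (1 + ((i : ℚ) - 1) * i / (2 * D)) := by rw [ha]; ring
      _ ≤ 4 := by linarith [ih']

/-- If `k(g)/√g → ∞` then `C(0^{k(g)}, 2^{3g−3+k(g)}) → 0` as `g → ∞`. -/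
theorem tendsto_zero_of_many_zeros (C : List ℕ → ℚ) (hC : IsNormalizedWitten C)
    (k : ℕ → ℕ)
    (hk : Filter.Tendsto (fun g : ℕ => (k g : ℝ) / Real.sqrt g) Filter.atTop Filter.atTop) :
    Filter.Tendsto
      (fun g : ℕ => (C (List.replicate (k g) 0 ++ List.replicate (3 * g - 3 + k g) 2) : ℝ))
      Filter.atTop (nhds 0) := by
  rw [Metric.tendsto_atTop]
  intro ε hε
  set T : ℝ := max 10 (3200 / ε) with hT
  have hT10 : (10 : ℝ) ≤ T := le_max_left _ _
  have hTe : 3200 / ε ≤ T := le_max_right _ _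
  obtain ⟨g0, hg0⟩ := Filter.eventually_atTop.1 (Filter.tendsto_atTop.1 hk T)
  refine ⟨max g0 2, fun g hg => ?_⟩
  have hgT := hg0 g (le_trans (le_max_left _ _) hg)
  have hg2 : 2 ≤ g := le_trans (le_max_right _ _) hg
  have hg2' : (2 : ℝ) ≤ g := by exact_mod_cast hg2
  have hsq1 : (1 : ℝ) ≤ Real.sqrt g := by
    rw [Real.one_le_sqrt]; linarith
  rw [le_div_iff₀ (by linarith)] at hgT
  have hkT : T ≤ (k g : ℝ) := by nlinarith
  have hk10 : 10 ≤ k g := by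
    have : (10 : ℝ) ≤ k g := by linarith
    exact_mod_cast this
  have hnn : 0 ≤ C (List.replicate (k g) 0 ++ List.replicate (3 * g - 3 + k g) 2) := by
    refine C_nonneg' hC _ ?_
    intro h
    have := congrArg List.length h
    simp at this
    omega
  have hb := zt_bound hC g (k g) hg2 (k g - 2) (by omega)
  rw [show k g - 2 + 2 = k g by omega, Nat.cast_sub (by omega)] at hb
  set c := C (List.replicate (k g) 0 ++ List.replicate (3 * g - 3 + k g) 2)
  have hb' : (c : ℝ) * (1 + ((k g : ℝ) - 2 - 1) * (k g - 2) / (2 * (5 * (3 * g + k g)))) ≤ 4 := by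
    exact_mod_cast hb
  have hnn' : (0 : ℝ) ≤ c := by exact_mod_cast hnn
  rw [Real.dist_eq, sub_zero, abs_of_nonneg hnn']
  set x : ℝ := (k g : ℝ)
  have hx10 : (10 : ℝ) ≤ x := by linarith
  have hgx : T * g ≤ x ^ 2 := by
    have h1 : (T * Real.sqrt g) ^ 2 ≤ x ^ 2 := by gcongr
    rw [mul_pow, Real.sq_sqrt (by linarith)] at h1
    nlinarith
  have hD : (0 : ℝ) < 2 * (5 * (3 * g + x)) := by linarith
  have hlow : T / 160 ≤ (x - 2 - 1) * (x - 2) / (2 * (5 * (3 * g + x))) := by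
    rw [le_div_iff₀ hD]
    nlinarith
  have hc1 : (c : ℝ) * (T / 160) < 5 := by
    have := mul_le_mul_of_nonneg_left hlow hnn'
    nlinarith
  have hεT : 3200 ≤ T * ε := by
    rwa [div_le_iff₀ hε] at hTe
  by_contra hcon
  push Not at hcon
  nlinarith

end WittenAsym
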